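/- Let E be a complex normed vector space and let ψ : E → ℝ be twice (real) Fréchet differentiable at p ∈ E, with ψ(x) ≥ 0 for all x ∈ E. Assume the Levi form of ψ is positive semidefinite at p. If v ∈ E satisfies L_{ψ²}(p,v) = 0, then Dψ(p)(v) = 0, Dψ(p)(i·v) = 0, and ψ(p)·L_ψ(p,v) = 0. In particular, dψ(p) vanishes on every direction in which both ψ and ψ² have degenerate Levi form at p. -/

import Mathlib

open Complex Filter

/-- The Levi form (up to a positive constant) of a function `f : E → ℝ` at `p` in the
direction `v`: `L_f(p,v) = D²f(p)(v,v) + D²f(p)(i·v, i·v)`, where the second derivative is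
the second real Fréchet derivative `fderiv ℝ (fderiv ℝ f) p`. -/
noncomputable def leviForm {E : Type*} [NormedAddCommGroup E] [NormedSpace ℂ E]
    (f : E → ℝ) (p v : E) : ℝ :=
  fderiv ℝ (fderiv ℝ f) p v v + fderiv ℝ (fderiv ℝ f) p (Complex.I • v) (Complex.I • v)

/-- The second derivative of `ψ ^ 2` at a point where `ψ` is twice differentiable. -/
theorem fderiv_fderiv_sq_apply {E : Type*} [NormedAddCommGroup E] [NormedSpace ℝ E]
    {ψ : E → ℝ} {p : E} (h1 : ∀ᶠ x in nhds p, DifferentiableAt ℝ ψ x)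
    (h2 : DifferentiableAt ℝ (fderiv ℝ ψ) p) (v w : E) :
    fderiv ℝ (fderiv ℝ fun x => ψ x ^ 2) p v w =
      2 * (ψ p * fderiv ℝ (fderiv ℝ ψ) p v w + fderiv ℝ ψ p v * fderiv ℝ ψ p w) := by
  have hsq : fderiv ℝ (fun x => ψ x ^ 2) =ᶠ[nhds p] fun x => (2 * ψ x) • fderiv ℝ ψ x := by
    filter_upwards [h1] with x hx
    rw [(hx.hasFDerivAt.pow 2).fderiv]
    simp
  rw [hsq.fderiv_eq,
    ((h1.self_of_nhds.hasFDerivAt.const_mul 2).fun_smul h2.hasFDerivAt).fderiv]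
  simp only [add_apply, smul_apply, ContinuousLinearMap.smulRight_apply, smul_eq_mul]
  ring

/-- The Levi form of `ψ ^ 2` in terms of the Levi form and the differential of `ψ`. -/
theorem leviForm_sq {E : Type*} [NormedAddCommGroup E] [NormedSpace ℂ E]
    {ψ : E → ℝ} {p : E} (h1 : ∀ᶠ x in nhds p, DifferentiableAt ℝ ψ x)
    (h2 : DifferentiableAt ℝ (fderiv ℝ ψ) p) (v : E) :
    leviForm (fun x => ψ x ^ 2) p v =
      2 * (ψ p * leviForm ψ p v + fderiv ℝ ψ p v ^ 2 + fderiv ℝ ψ p (Complex.I • v) ^ 2) := by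
  simp only [leviForm, fderiv_fderiv_sq_apply h1 h2]
  ring

/-- for `ψ ≥ 0` twice real Fréchet differentiable at `p` with Levi form
positive semidefinite at `p`, if `L_{ψ²}(p,v) = 0` then `Dψ(p)(v) = 0`,
`Dψ(p)(i·v) = 0` and `ψ(p)·L_ψ(p,v) = 0`. -/
theorem leviForm_sq_degenerate {E : Type*} [NormedAddCommGroup E] [NormedSpace ℂ E]
    (ψ : E → ℝ) (p : E)
    (h1 : ∀ᶠ x in nhds p, DifferentiableAt ℝ ψ x)
    (h2 : DifferentiableAt ℝ (fderiv ℝ ψ) p)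
    (hnonneg : ∀ x, 0 ≤ ψ x)
    (hpsh : ∀ v : E, 0 ≤ leviForm ψ p v)
    (v : E) (hv : leviForm (fun x => ψ x ^ 2) p v = 0) :
    fderiv ℝ ψ p v = 0 ∧ fderiv ℝ ψ p (Complex.I • v) = 0 ∧ ψ p * leviForm ψ p v = 0 := by
  rw [leviForm_sq h1 h2] at hv
  have hψ := mul_nonneg (hnonneg p) (hpsh v)
  have hd := sq_nonneg (fderiv ℝ ψ p v)
  have hdI := sq_nonneg (fderiv ℝ ψ p (Complex.I • v))
  exact ⟨pow_eq_zero_iff two_ne_zero |>.mp (by linarith),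
    pow_eq_zero_iff two_ne_zero |>.mp (by linarith), by linarith⟩
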